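/- Fix q ∈ ℝ with q ≠ 0 and q² ≠ 1, and fix λ ∈ ℝ∖{0} (playing the role of q^ν). Define Â = λ⁻¹(M̂₁ + qM̂₂), B̂ = (1/(2(q−q⁻¹)))[λ²(R̂₁ + q⁻¹R̂₂) − λ⁻²(R̂₁ + qR̂₂)], Ĉ = 2L̂, D̂ = λ(M̂₁ + q⁻¹M̂₂), where L̂, M̂₁, M̂₂, R̂₁, R̂₂ are the S-Heun operators on the q-linear grid. Then, as operator identities (pointwise at all z ≠ 0, on all functions f : ℝ → ℝ), the relations of U_q(sl₂) hold: ÂB̂ = qB̂Â, B̂D̂ = qD̂B̂, ĈÂ = qÂĈ, D̂Ĉ = qĈD̂, [B̂,Ĉ] = (Â² − D̂²)/(q−q⁻¹), [Â,D̂] = 0, together with the additional relation ÂD̂ = D̂Â = 1 (the identity operator). -/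

import Mathlib

/-- Lowering S-Heun operator `L̂ = (q−q⁻¹)⁻¹ z⁻¹(T̂₊−T̂₋)` on the q-linear grid. -/
noncomputable def hL (q : ℝ) (f : ℝ → ℝ) : ℝ → ℝ :=
  fun z => (q - q⁻¹)⁻¹ * z⁻¹ * (f (q*z) - f (q⁻¹*z))
/-- Stabilizing S-Heun operator `M̂₁ = (q−q⁻¹)⁻¹(−q⁻¹T̂₊+qT̂₋)`. -/
noncomputable def hM1 (q : ℝ) (f : ℝ → ℝ) : ℝ → ℝ :=
  fun z => (q - q⁻¹)⁻¹ * (-q⁻¹ * f (q*z) + q * f (q⁻¹*z))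
/-- Stabilizing S-Heun operator `M̂₂ = (q−q⁻¹)⁻¹(T̂₊−T̂₋)`. -/
noncomputable def hM2 (q : ℝ) (f : ℝ → ℝ) : ℝ → ℝ :=
  fun z => (q - q⁻¹)⁻¹ * (f (q*z) - f (q⁻¹*z))
/-- Raising S-Heun operator `R̂₁ = (q−q⁻¹)⁻¹ z(−q⁻¹T̂₊+qT̂₋)`. -/
noncomputable def hR1 (q : ℝ) (f : ℝ → ℝ) : ℝ → ℝ :=
  fun z => (q - q⁻¹)⁻¹ * z * (-q⁻¹ * f (q*z) + q * f (q⁻¹*z))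
/-- Raising S-Heun operator `R̂₂ = (q−q⁻¹)⁻¹ z(T̂₊−T̂₋)`. -/
noncomputable def hR2 (q : ℝ) (f : ℝ → ℝ) : ℝ → ℝ :=
  fun z => (q - q⁻¹)⁻¹ * z * (f (q*z) - f (q⁻¹*z))

/-- `Â = λ⁻¹(M̂₁ + qM̂₂)` (here `lam` plays the role of `q^ν`). -/
noncomputable def uqA (q lam : ℝ) (f : ℝ → ℝ) : ℝ → ℝ :=
  fun z => lam⁻¹ * (hM1 q f z + q * hM2 q f z)
/-- `B̂ = (1/(2(q−q⁻¹)))[λ²(R̂₁ + q⁻¹R̂₂) − λ⁻²(R̂₁ + qR̂₂)]`. -/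
noncomputable def uqB (q lam : ℝ) (f : ℝ → ℝ) : ℝ → ℝ :=
  fun z => (1 / (2*(q - q⁻¹))) *
    (lam^2 * (hR1 q f z + q⁻¹ * hR2 q f z) - (lam⁻¹)^2 * (hR1 q f z + q * hR2 q f z))
/-- `Ĉ = 2L̂`. -/
noncomputable def uqC (q : ℝ) (f : ℝ → ℝ) : ℝ → ℝ := fun z => 2 * hL q f z
/-- `D̂ = λ(M̂₁ + q⁻¹M̂₂)`. -/
noncomputable def uqD (q lam : ℝ) (f : ℝ → ℝ) : ℝ → ℝ :=
  fun z => lam * (hM1 q f z + q⁻¹ * hM2 q f z)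

lemma aux_ne (q : ℝ) (hq : q ≠ 0) (hq2 : q^2 ≠ 1) : q - q⁻¹ ≠ 0 := by
  intro h
  apply hq2
  have h1 : q * (q - q⁻¹) = 0 := by rw [h, mul_zero]
  rw [mul_sub, mul_inv_cancel₀ hq] at h1
  linarith

lemma auxA (q lam : ℝ) (h : q - q⁻¹ ≠ 0) (f : ℝ → ℝ) (z : ℝ) :
    uqA q lam f z = lam⁻¹ * f (q*z) := by
  unfold uqA hM1 hM2
  linear_combination (lam⁻¹ * f (q*z)) * inv_mul_cancel₀ h

lemma auxD (q lam : ℝ) (h : q - q⁻¹ ≠ 0) (f : ℝ → ℝ) (z : ℝ) :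
    uqD q lam f z = lam * f (q⁻¹*z) := by
  unfold uqD hM1 hM2
  linear_combination (lam * f (q⁻¹*z)) * inv_mul_cancel₀ h

lemma auxB (q lam : ℝ) (h : q - q⁻¹ ≠ 0) (f : ℝ → ℝ) (z : ℝ) :
    uqB q lam f z = (1 / (2*(q - q⁻¹))) * z *
      (lam^2 * f (q⁻¹*z) - (lam⁻¹)^2 * f (q*z)) := by
  unfold uqB hR1 hR2
  linear_combination (1 / (2*(q - q⁻¹)) * z *
      (lam^2 * f (q⁻¹*z) - (lam⁻¹)^2 * f (q*z))) * inv_mul_cancel₀ h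

lemma auxC (q : ℝ) (f : ℝ → ℝ) (z : ℝ) :
    uqC q f z = 2 * ((q - q⁻¹)⁻¹ * z⁻¹ * (f (q*z) - f (q⁻¹*z))) := rfl

/-- The relations of `U_q(sl₂)` in the realization by q-grid S-Heun operators. -/
theorem stmt_11 (q lam : ℝ) (hq : q ≠ 0) (hq2 : q^2 ≠ 1) (hlam : lam ≠ 0) :
    (∀ (f : ℝ → ℝ) (z : ℝ), z ≠ 0 →
      uqA q lam (uqB q lam f) z = q * uqB q lam (uqA q lam f) z) ∧
    (∀ (f : ℝ → ℝ) (z : ℝ), z ≠ 0 →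
      uqB q lam (uqD q lam f) z = q * uqD q lam (uqB q lam f) z) ∧
    (∀ (f : ℝ → ℝ) (z : ℝ), z ≠ 0 →
      uqC q (uqA q lam f) z = q * uqA q lam (uqC q f) z) ∧
    (∀ (f : ℝ → ℝ) (z : ℝ), z ≠ 0 →
      uqD q lam (uqC q f) z = q * uqC q (uqD q lam f) z) ∧
    (∀ (f : ℝ → ℝ) (z : ℝ), z ≠ 0 →
      uqB q lam (uqC q f) z - uqC q (uqB q lam f) z
        = (uqA q lam (uqA q lam f) z - uqD q lam (uqD q lam f) z) / (q - q⁻¹)) ∧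
    (∀ (f : ℝ → ℝ) (z : ℝ), z ≠ 0 →
      uqA q lam (uqD q lam f) z - uqD q lam (uqA q lam f) z = 0) ∧
    (∀ (f : ℝ → ℝ) (z : ℝ), z ≠ 0 →
      uqA q lam (uqD q lam f) z = f z ∧ uqD q lam (uqA q lam f) z = f z) := by
  have h := aux_ne q hq hq2
  have e1 : ∀ z, q * (q⁻¹ * z) = z := fun z => mul_inv_cancel_left₀ hq z
  have e2 : ∀ z, q⁻¹ * (q * z) = z := fun z => inv_mul_cancel_left₀ hq z
  refine ⟨?_, ?_, ?_, ?_, ?_, ?_, ?_⟩ <;> intro f z hz <;>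
    simp only [auxA q lam h, auxB q lam h, auxC, auxD q lam h, e1, e2]
  · ring
  · generalize q - q⁻¹ = k at *
    field_simp
  · generalize q - q⁻¹ = k at *
    field_simp
  · generalize q - q⁻¹ = k at *
    field_simp
  · generalize f (q * (q * z)) = a
    generalize f (q⁻¹ * (q⁻¹ * z)) = b
    obtain ⟨k, hk⟩ : ∃ k, k = q - q⁻¹ := ⟨_, rfl⟩
    rw [← hk] at h ⊢
    have hk' : k * q = q ^ 2 - 1 := by rw [hk]; field_simp
    field_simp
    linear_combination (lam ^ 4 * b - a) * hk'
  · field_simp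
    ring
  · constructor <;> field_simp
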